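/- arXiv:2402.16643 — 4 statements merged into one kernel-verified Lean document; each statement's English description precedes it below -/
import Mathlib

section
/- Let q be a prime power and let a ≥ b ≥ 1 and 0 ≤ i ≤ b−1 be integers; set k := a + b − i. Let A be an a-dimensional and B a b-dimensional subspace of 𝔽_q^k with dim(A ∩ B) = i. Then the multiset M := χ_A + q^{a−b}·χ_B satisfies M(H) ∈ {s, s + q^{a−1}} for every hyperplane H, where s := [a−1]_q + q^{a−b}·[b−1]_q. Moreover #M = [a]_q + q^{a−b}·[b]_q, the minimum point multiplicity of M is 0, and the maximum point multiplicity of M equals q^{a−b} if i = 0 and q^{a−b} + 1 if i ≥ 1. -/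
/-- The points of `PG(k-1,q)`: the 1-dimensional `F`-subspaces of `F^k`. -/
abbrev ProjPoint (F : Type) [Field F] (k : ℕ) : Type :=
  {P : Submodule F (Fin k → F) // Module.finrank F P = 1}

/-- The hyperplanes of `PG(k-1,q)`: the `(k-1)`-dimensional `F`-subspaces of `F^k`. -/
abbrev ProjHyp (F : Type) [Field F] (k : ℕ) : Type :=
  {H : Submodule F (Fin k → F) // Module.finrank F H = k - 1}

/-- Additive extension of a function on points to subspaces:
`msum M S = Σ_{P point, P ⊆ S} M P`. -/
noncomputable def msum {F : Type} [Field F] {k : ℕ} {R : Type} [AddCommMonoid R]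
    (M : ProjPoint F k → R) (S : Submodule F (Fin k → F)) : R :=
  ∑ᶠ (P : ProjPoint F k) (_ : P.1 ≤ S), M P

/-- The Gaussian number `[m]_q = (q^m - 1)/(q - 1)`. -/
def gaussNum (q m : ℕ) : ℕ := (q ^ m - 1) / (q - 1)

open Module

lemma gaussNum_eq_geom_sum {q : ℕ} (hq : 2 ≤ q) (m : ℕ) :
    gaussNum q m = ∑ j ∈ Finset.range m, q ^ j :=
  (Nat.geomSum_eq hq m).symm

lemma gaussNum_succ {q : ℕ} (hq : 2 ≤ q) (m : ℕ) :
    gaussNum q (m + 1) = gaussNum q m + q ^ m := by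
  simp only [gaussNum_eq_geom_sum hq, Finset.sum_range_succ]

/-- The points contained in a subspace `S` are counted by `[dim S]_q`. -/
lemma card_projPoint_le {F : Type} [Field F] [Fintype F] {k : ℕ}
    (S : Submodule F (Fin k → F)) :
    Nat.card {P : ProjPoint F k // P.1 ≤ S} = gaussNum (Fintype.card F) (finrank F S) := by
  rw [gaussNum_eq_geom_sum Fintype.one_lt_card, ← Nat.card_eq_fintype_card,
    ← Projectivization.card_of_finrank F S rfl]
  have e : {Q : Submodule F S // finrank F Q = 1} ≃
      {Q : {Q : Submodule F (Fin k → F) // Q ≤ S} // finrank F Q.1 = 1} :=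
    (Submodule.MapSubtype.orderIso S).toEquiv.subtypeEquiv fun Q => by
      rw [← Submodule.finrank_map_subtype_eq S Q]
      rfl
  exact Nat.card_congr ((Equiv.subtypeSubtypeEquivSubtypeInter _ (· ≤ S)).trans
    ((Equiv.subtypeEquivRight fun _ => and_comm).trans
      (Equiv.subtypeSubtypeEquivSubtypeInter (· ≤ S) (finrank F · = 1)).symm) |>.trans
    (e.symm.trans (Projectivization.equivSubmodule F S).symm))

open Classical in
/-- Summing the characteristic function of `A` over the points of `S` counts the points of
`A ⊓ S`. -/
lemma msum_ite_le {F : Type} [Field F] [Fintype F] {k : ℕ} (A S : Submodule F (Fin k → F)) :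
    msum (fun P => if P.1 ≤ A then 1 else 0) S =
      gaussNum (Fintype.card F) (finrank F ↥(A ⊓ S)) := by
  have := Fintype.ofFinite (ProjPoint F k)
  rw [← card_projPoint_le, msum, finsum_eq_sum_of_fintype, Nat.card_eq_fintype_card,
    Fintype.card_subtype, Finset.card_filter]
  refine Finset.sum_congr rfl fun P _ => ?_
  rw [finsum_eq_if]
  by_cases h : P.1 ≤ S <;> simp [h]

open Classical in
lemma msum_add_mul {F : Type} [Field F] [Fintype F] {k : ℕ} (f g : ProjPoint F k → ℕ) (c : ℕ)
    (S : Submodule F (Fin k → F)) :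
    msum (fun P => f P + c * g P) S = msum f S + c * msum g S := by
  have := Fintype.ofFinite (ProjPoint F k)
  simp only [msum, finsum_eq_sum_of_fintype, finsum_eq_if, Finset.mul_sum,
    ← Finset.sum_add_distrib]
  refine Finset.sum_congr rfl fun P _ => ?_
  split_ifs <;> simp

/-- A subspace not contained in a hyperplane meets it in codimension one. -/
lemma finrank_inf_of_not_le {F V : Type*} [Field F] [AddCommGroup V] [Module F V]
    [FiniteDimensional F V] {A H : Submodule F V} (hH : finrank F V ≤ finrank F H + 1)
    (hAH : ¬ A ≤ H) : finrank F ↥(A ⊓ H) = finrank F A - 1 := by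
  have h₁ := Submodule.finrank_sup_add_finrank_inf_eq A H
  have h₂ : finrank F H < finrank F ↥(A ⊔ H) :=
    Submodule.finrank_lt_finrank_of_lt (lt_of_le_of_ne le_sup_right fun h => hAH (h ▸ le_sup_left))
  have h₃ := Submodule.finrank_le (A ⊔ H)
  omega

/-- If `B` is not contained in `A`, some point of `B` lies outside `A`. -/
lemma exists_projPoint_of_not_le {F : Type} [Field F] {k : ℕ} {A B : Submodule F (Fin k → F)}
    (h : ¬ B ≤ A) : ∃ P : ProjPoint F k, ¬ P.1 ≤ A ∧ P.1 ≤ B := by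
  obtain ⟨x, hxB, hxA⟩ := SetLike.not_le_iff_exists.mp h
  have hx : x ≠ 0 := fun h0 => hxA (h0 ▸ A.zero_mem)
  exact ⟨⟨F ∙ x, finrank_span_singleton hx⟩, by simpa using hxA, by simpa using hxB⟩

/-- Two subspaces neither of which contains the other do not cover all points. -/
lemma exists_projPoint_not_le_not_le {F : Type} [Field F] {k : ℕ}
    {A B : Submodule F (Fin k → F)} (hAB : ¬ A ≤ B) (hBA : ¬ B ≤ A) :
    ∃ P : ProjPoint F k, ¬ P.1 ≤ A ∧ ¬ P.1 ≤ B := by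
  obtain ⟨x, hxA, hxB⟩ := SetLike.not_le_iff_exists.mp hAB
  obtain ⟨y, hyB, hyA⟩ := SetLike.not_le_iff_exists.mp hBA
  have hA : x + y ∉ A := fun h => hyA ((A.add_mem_iff_right hxA).mp h)
  have hB : x + y ∉ B := fun h => hxB ((B.add_mem_iff_left hyB).mp h)
  have h0 : x + y ≠ 0 := fun h => hA (h ▸ A.zero_mem)
  exact ⟨⟨F ∙ (x + y), finrank_span_singleton h0⟩, by simpa using hA, by simpa using hB⟩

/-- for an `a`-space `A` and a `b`-space `B` with `a ≥ b ≥ 1`,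
`dim(A ∩ B) = i ≤ b-1` and ambient dimension `k = a + b - i`, the multiset
`M = χ_A + q^{a-b}·χ_B` is a two-character multiset with hyperplane multiplicities
`s = [a-1]_q + q^{a-b}·[b-1]_q` and `s + q^{a-1}`, cardinality `[a]_q + q^{a-b}·[b]_q`,
minimum point multiplicity `0`, and maximum point multiplicity `q^{a-b}` if `i = 0`
and `q^{a-b} + 1` if `i ≥ 1`. -/
theorem two_subspaces_construction
    (F : Type) [Field F] [Fintype F] (a b i : ℕ) (hb : 1 ≤ b) (hba : b ≤ a) (hib : i < b)
    (A B : Submodule F (Fin (a + b - i) → F))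
    (hA : Module.finrank F A = a) (hB : Module.finrank F B = b)
    (hAB : Module.finrank F ↥(A ⊓ B) = i)
    (M : ProjPoint F (a + b - i) → ℕ)
    (hM11 : ∀ P : ProjPoint F (a + b - i), P.1 ≤ A → P.1 ≤ B →
      M P = 1 + Fintype.card F ^ (a - b))
    (hM10 : ∀ P : ProjPoint F (a + b - i), P.1 ≤ A → ¬ P.1 ≤ B → M P = 1)
    (hM01 : ∀ P : ProjPoint F (a + b - i), ¬ P.1 ≤ A → P.1 ≤ B →
      M P = Fintype.card F ^ (a - b))
    (hM00 : ∀ P : ProjPoint F (a + b - i), ¬ P.1 ≤ A → ¬ P.1 ≤ B → M P = 0) :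
    (∀ H : ProjHyp F (a + b - i),
      msum M H.1 = gaussNum (Fintype.card F) (a - 1)
          + Fintype.card F ^ (a - b) * gaussNum (Fintype.card F) (b - 1) ∨
      msum M H.1 = gaussNum (Fintype.card F) (a - 1)
          + Fintype.card F ^ (a - b) * gaussNum (Fintype.card F) (b - 1)
          + Fintype.card F ^ (a - 1)) ∧
    msum M (⊤ : Submodule F (Fin (a + b - i) → F))
      = gaussNum (Fintype.card F) a + Fintype.card F ^ (a - b) * gaussNum (Fintype.card F) b ∧
    (∃ P : ProjPoint F (a + b - i), M P = 0) ∧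
    (i = 0 →
      (∀ P : ProjPoint F (a + b - i), M P ≤ Fintype.card F ^ (a - b)) ∧
      (∃ P : ProjPoint F (a + b - i), M P = Fintype.card F ^ (a - b))) ∧
    (1 ≤ i →
      (∀ P : ProjPoint F (a + b - i), M P ≤ Fintype.card F ^ (a - b) + 1) ∧
      (∃ P : ProjPoint F (a + b - i), M P = Fintype.card F ^ (a - b) + 1)) := by
  classical
  have hq : 2 ≤ Fintype.card F := Fintype.one_lt_card
  set q := Fintype.card F
  have hc : 1 ≤ q ^ (a - b) := Nat.one_le_pow _ _ (by omega)
  have hsum : ∀ S : Submodule F (Fin (a + b - i) → F), msum M S =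
      gaussNum q (finrank F ↥(A ⊓ S)) + q ^ (a - b) * gaussNum q (finrank F ↥(B ⊓ S)) := by
    intro S
    rw [← msum_ite_le, ← msum_ite_le, ← msum_add_mul]
    congr 1
    funext P
    by_cases h₁ : P.1 ≤ A <;> by_cases h₂ : P.1 ≤ B <;> simp [*]
  have hBA : ¬ B ≤ A := fun h => by
    rw [inf_eq_right.mpr h] at hAB
    omega
  have hAB' : ¬ A ≤ B := fun h => by
    rw [inf_eq_left.mpr h] at hAB
    omega
  refine ⟨fun H => ?_, ?_, ?_, fun hi => ⟨fun P => ?_, ?_⟩, fun hi => ⟨fun P => ?_, ?_⟩⟩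
  · have hH : finrank F (Fin (a + b - i) → F) ≤ finrank F H.1 + 1 := by
      rw [H.2, finrank_fin_fun]
      omega
    obtain ⟨m, rfl⟩ := Nat.exists_eq_add_of_le' (hb.trans hba)
    obtain ⟨n, rfl⟩ := Nat.exists_eq_add_of_le' hb
    rw [hsum]
    simp only [Nat.add_sub_cancel]
    by_cases h₁ : A ≤ H.1
    · have h₂ : ¬ B ≤ H.1 := fun h₂ => by
        have h₃ := Submodule.finrank_mono (sup_le h₁ h₂)
        have h₄ := Submodule.finrank_sup_add_finrank_inf_eq A B
        have h₅ := H.2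
        omega
      right
      rw [inf_eq_left.mpr h₁, finrank_inf_of_not_le hH h₂, hA, hB, gaussNum_succ hq,
        Nat.add_sub_cancel]
      ring
    · rw [finrank_inf_of_not_le hH h₁, hA, Nat.add_sub_cancel]
      by_cases h₂ : B ≤ H.1
      · right
        rw [inf_eq_left.mpr h₂, hB, gaussNum_succ hq, mul_add, ← pow_add,
          show m + 1 - (n + 1) + n = m by omega]
        ring
      · left
        rw [finrank_inf_of_not_le hH h₂, hB, Nat.add_sub_cancel]
  · rw [hsum, inf_top_eq, inf_top_eq, hA, hB]
  · obtain ⟨P, h₁, h₂⟩ := exists_projPoint_not_le_not_le hAB' hBA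
    exact ⟨P, hM00 P h₁ h₂⟩
  · by_cases h₁ : P.1 ≤ A <;> by_cases h₂ : P.1 ≤ B
    · have h₃ := Submodule.finrank_mono (le_inf h₁ h₂)
      have h₄ := P.2
      omega
    all_goals simp [*]
  · obtain ⟨P, h₁, h₂⟩ := exists_projPoint_of_not_le hBA
    exact ⟨P, hM01 P h₁ h₂⟩
  · by_cases h₁ : P.1 ≤ A <;> by_cases h₂ : P.1 ≤ B <;> simp [*, add_comm]
  · have h : ¬ A ⊓ B ≤ ⊥ := fun h => by
      rw [le_bot_iff.mp h, finrank_bot] at hAB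
      omega
    obtain ⟨P, -, hP⟩ := exists_projPoint_of_not_le h
    exact ⟨P, by rw [hM11 P (hP.trans inf_le_left) (hP.trans inf_le_right), add_comm]⟩
end

section
/- Let q be a prime power, k ≥ 3, let ℋ' be a set of hyperplanes of PG(k−1,q), and let M be a multiset of points such that M(H) = s for every H ∈ ℋ' and M(H) = t for every hyperplane H ∉ ℋ', where s, t ∈ ℕ with s > t. Set r := #ℋ', Δ := s − t, φ(P) := #{H ∈ ℋ' : P ⊆ H} for each point P, and m := min over points P of φ(P). If there exists a point Q with M(Q) = 0, then t = (Δ/q^{k−2})·[k−2]_q·(r − m) − Δ·m, and M(P) = Δ·(φ(P) − m)/q^{k−2} for every point P. Moreover, if the greatest common divisor of the point multiplicities {M(P) : P point} equals 1, then Δ divides q^{k−2}. -/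
open Module in
/-- Duality: hyperplanes containing `W` correspond to the lines of the annihilator of `W`. -/
noncomputable def hyperplanesAboveEquiv {F : Type} [Field F] {k : ℕ} (hk : 1 ≤ k)
    (W : Submodule F (Fin k → F)) :
    {H : ProjHyp F k // W ≤ H.1} ≃
      {L : Submodule F W.dualAnnihilator // finrank F L = 1} where
  toFun H := ⟨H.1.1.dualAnnihilator.comap W.dualAnnihilator.subtype, by
    have hle : H.1.1.dualAnnihilator ≤ W.dualAnnihilator :=
      Submodule.dualAnnihilator_anti H.2
    rw [(Submodule.comapSubtypeEquivOfLe hle).finrank_eq]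
    have h := Subspace.finrank_add_finrank_dualAnnihilator_eq H.1.1
    have hH := H.1.2
    rw [finrank_fin_fun] at h
    omega⟩
  invFun L := ⟨⟨(L.1.map W.dualAnnihilator.subtype).dualCoannihilator, by
    have h := Subspace.finrank_add_finrank_dualCoannihilator_eq
      (L.1.map W.dualAnnihilator.subtype)
    have hL := L.2
    rw [Submodule.finrank_map_subtype_eq, finrank_fin_fun] at h
    omega⟩, by
    rw [← Submodule.le_dualAnnihilator_iff_le_dualCoannihilator]
    exact Submodule.map_subtype_le _ _⟩
  left_inv H := by
    have hle : H.1.1.dualAnnihilator ≤ W.dualAnnihilator :=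
      Submodule.dualAnnihilator_anti H.2
    ext1
    ext1
    simp only [Submodule.map_comap_subtype, inf_eq_right.2 hle]
    exact Subspace.dualAnnihilator_dualCoannihilator_eq
  right_inv L := by
    ext1
    simp only [Subspace.dualCoannihilator_dualAnnihilator_eq]
    exact Submodule.comap_map_eq_of_injective (Submodule.injective_subtype _) _

open Module in
lemma card_hyperplanes_above {F : Type} [Field F] [Fintype F] {k : ℕ} (hk : 1 ≤ k)
    (W : Submodule F (Fin k → F)) {j : ℕ} (hW : finrank F W + j = k) :
    Nat.card {H : ProjHyp F k // W ≤ H.1} = ∑ i ∈ Finset.range j, Fintype.card F ^ i := by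
  have h := Subspace.finrank_add_finrank_dualAnnihilator_eq W
  rw [finrank_fin_fun] at h
  rw [Nat.card_congr ((hyperplanesAboveEquiv hk W).trans
      (Projectivization.equivSubmodule F W.dualAnnihilator).symm),
    Projectivization.card_of_finrank F _ (n := j) (by omega), Nat.card_eq_fintype_card]

open Module in
lemma finrank_sup_of_ne {F : Type} [Field F] {k : ℕ} {P Q : ProjPoint F k} (h : P ≠ Q) :
    finrank F (P.1 ⊔ Q.1 : Submodule F (Fin k → F)) = 2 := by
  have hP := P.2
  have hQ := Q.2
  have hsum := Submodule.finrank_sup_add_finrank_inf_eq P.1 Q.1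
  have hinf : finrank F (P.1 ⊓ Q.1 : Submodule F (Fin k → F)) ≠ 1 := fun h1 ↦ h <| Subtype.ext <|
    (Submodule.eq_of_le_of_finrank_eq inf_le_left (h1.trans hP.symm)).symm.trans
      (Submodule.eq_of_le_of_finrank_eq inf_le_right (h1.trans hQ.symm))
  have hle := Submodule.finrank_mono (inf_le_left : P.1 ⊓ Q.1 ≤ P.1)
  omega

open scoped Classical in
lemma msum_eq_sum_ite {F : Type} [Field F] {k : ℕ} [Fintype (ProjPoint F k)]
    (M : ProjPoint F k → ℕ) (S : Submodule F (Fin k → F)) :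
    msum M S = ∑ P : ProjPoint F k, if P.1 ≤ S then M P else 0 := by
  simp only [msum, finsum_eq_if, finsum_eq_sum_of_fintype]

/-- Double counting of the incident pairs of points and hyperplanes above `S`. -/
lemma sum_mul_card_hyperplanes_above {F : Type} [Field F] [Fintype F] {k : ℕ}
    [Fintype (ProjPoint F k)]
    {Hs : Set (ProjHyp F k)} {M : ProjPoint F k → ℕ} {t Δ : ℕ}
    (hs : ∀ H ∈ Hs, msum M H.1 = t + Δ)
    (ht : ∀ H : ProjHyp F k, H ∉ Hs → msum M H.1 = t) (S : Submodule F (Fin k → F)) :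
    ∑ P : ProjPoint F k, M P * Nat.card {H : ProjHyp F k // S ⊔ P.1 ≤ H.1} =
      t * Nat.card {H : ProjHyp F k // S ≤ H.1} + Δ * {H ∈ Hs | S ≤ H.1}.ncard := by
  classical
  have : Fintype (ProjHyp F k) := Fintype.ofFinite _
  have hM (H : ProjHyp F k) : msum M H.1 = t + if H ∈ Hs then Δ else 0 := by
    by_cases h : H ∈ Hs
    · simp [h, hs H h]
    · simp [h, ht H h]
  have hcard : {H ∈ Hs | S ≤ H.1}.ncard =
      (Finset.univ.filter fun H : ProjHyp F k ↦ H ∈ Hs ∧ S ≤ H.1).card := by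
    rw [← Set.ncard_coe_finset]
    simp
  calc
    _ = ∑ P : ProjPoint F k, ∑ H : ProjHyp F k,
          if S ≤ H.1 then (if P.1 ≤ H.1 then M P else 0) else 0 := by
      refine Finset.sum_congr rfl fun P _ ↦ ?_
      rw [Nat.card_eq_fintype_card, Fintype.card_subtype, Finset.card_filter, Finset.mul_sum]
      refine Finset.sum_congr rfl fun H _ ↦ ?_
      simp only [sup_le_iff, ite_and, mul_ite, mul_one, mul_zero]
    _ = ∑ H : ProjHyp F k, if S ≤ H.1 then msum M H.1 else 0 := by
      rw [Finset.sum_comm]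
      refine Finset.sum_congr rfl fun H _ ↦ ?_
      split_ifs
      · rw [msum_eq_sum_ite]
      · simp
    _ = _ := by
      rw [hcard, Nat.card_eq_fintype_card, Fintype.card_subtype, Finset.card_filter,
        Finset.card_filter, Finset.mul_sum, Finset.mul_sum, ← Finset.sum_add_distrib]
      refine Finset.sum_congr rfl fun H _ ↦ ?_
      rw [hM]
      by_cases h1 : S ≤ H.1 <;> by_cases h2 : H ∈ Hs <;> simp [h1, h2]

/-- normalized point multiplicities. If `M` has hyperplane multiplicity `s`
on `ℋ'` and `t < s` elsewhere, `m` is the minimum of `φ(P) = #{H ∈ ℋ' : P ⊆ H}`, and some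
point has multiplicity `0`, then `t = (Δ/q^{k-2})·[k-2]_q·(r−m) − Δ·m` and
`M(P) = Δ·(φ(P)−m)/q^{k-2}` for all points `P`; moreover if the gcd of all point
multiplicities is `1` then `Δ = s − t` divides `q^{k-2}`. -/
theorem normalized_point_multiplicities
    (F : Type) [Field F] [Fintype F] (k : ℕ) (hk : 3 ≤ k)
    (Hs : Set (ProjHyp F k)) (M : ProjPoint F k → ℕ) (s t : ℕ) (hst : t < s)
    (hs : ∀ H ∈ Hs, msum M H.1 = s)
    (ht : ∀ H : ProjHyp F k, H ∉ Hs → msum M H.1 = t)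
    (m : ℕ)
    (hm1 : ∀ P : ProjPoint F k, m ≤ {H ∈ Hs | P.1 ≤ H.1}.ncard)
    (hm2 : ∃ P : ProjPoint F k, {H ∈ Hs | P.1 ≤ H.1}.ncard = m)
    (hQ : ∃ Q : ProjPoint F k, M Q = 0) :
    ((t : ℚ) = (((s : ℚ) - (t : ℚ)) / (Fintype.card F : ℚ) ^ (k - 2))
        * (gaussNum (Fintype.card F) (k - 2) : ℚ) * ((Hs.ncard : ℚ) - (m : ℚ))
      - ((s : ℚ) - (t : ℚ)) * (m : ℚ)) ∧
    (∀ P : ProjPoint F k,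
      (M P : ℚ) = ((s : ℚ) - (t : ℚ)) * (({H ∈ Hs | P.1 ≤ H.1}.ncard : ℚ) - (m : ℚ))
        / (Fintype.card F : ℚ) ^ (k - 2)) ∧
    ((∀ d : ℕ, (∀ P : ProjPoint F k, d ∣ M P) → d = 1) →
      (s - t) ∣ Fintype.card F ^ (k - 2)) := by
  obtain ⟨j, rfl⟩ : ∃ j, k = j + 2 := ⟨k - 2, by omega⟩
  obtain ⟨Δ, rfl⟩ := Nat.exists_eq_add_of_lt hst
  rw [add_assoc] at *
  generalize Δ + 1 = D at *
  have hD : 0 < D := by omega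
  classical
  have : Fintype (ProjPoint F (j + 2)) := Fintype.ofFinite _
  have hq : 1 < Fintype.card F := Fintype.one_lt_card
  have hgauss : gaussNum (Fintype.card F) j = ∑ i ∈ Finset.range j, Fintype.card F ^ i :=
    (Nat.geomSum_eq hq j).symm
  set q := Fintype.card F
  set g : ℕ → ℕ := fun n ↦ ∑ i ∈ Finset.range n, q ^ i with hg
  set φ : ProjPoint F (j + 2) → ℕ := fun P ↦ {H ∈ Hs | P.1 ≤ H.1}.ncard
  set N := ∑ P, M P with hN
  have hg1 : g (j + 1) = g j + q ^ j := Finset.sum_range_succ _ _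
  have hg2 : g (j + 2) = g j + q ^ j + q ^ (j + 1) := by
    simp only [hg, Finset.sum_range_succ]
  have hgq : g j * q + 1 = g j + q ^ j := by
    have := Finset.sum_range_succ' (fun i ↦ q ^ i) j
    simp only [pow_succ, pow_zero, ← Finset.sum_mul] at this
    exact this.symm.trans hg1
  have hpoint (P : ProjPoint F (j + 2)) :
      q ^ j * M P + g j * N = t * g (j + 1) + D * φ P := by
    have h := sum_mul_card_hyperplanes_above hs ht P.1
    rw [card_hyperplanes_above (by omega) P.1 (j := j + 1) (by rw [P.2]; omega)] at h
    rw [← h, hN, Finset.mul_sum, ← Finset.sum_erase_add _ _ (Finset.mem_univ P),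
      ← Finset.sum_erase_add _ (fun P' ↦ M P' * _) (Finset.mem_univ P), sup_idem,
      card_hyperplanes_above (by omega) P.1 (j := j + 1) (by rw [P.2]; omega)]
    have herase : ∑ P' ∈ Finset.univ.erase P,
        M P' * Nat.card {H : ProjHyp F (j + 2) // P.1 ⊔ P'.1 ≤ H.1} =
          ∑ P' ∈ Finset.univ.erase P, g j * M P' := by
      refine Finset.sum_congr rfl fun P' hP' ↦ ?_
      rw [card_hyperplanes_above (by omega) _ (j := j)
        (by rw [finrank_sup_of_ne (Finset.ne_of_mem_erase hP').symm]; omega), mul_comm]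
    rw [herase]
    change _ = _ + M P * g (j + 1)
    rw [hg1]
    ring
  have htotal : g (j + 1) * N = t * g (j + 2) + D * Hs.ncard := by
    have h := sum_mul_card_hyperplanes_above hs ht ⊥
    rw [card_hyperplanes_above (by omega) _ (j := j + 2) (by simp)] at h
    simp only [bot_le, and_true, Set.ofPred_mem_eq, bot_sup_eq] at h
    rw [← h, hN, Finset.mul_sum]
    refine Finset.sum_congr rfl fun P _ ↦ ?_
    rw [card_hyperplanes_above (by omega) P.1 (j := j + 1) (by rw [P.2]; omega), mul_comm]
  obtain ⟨P₀, hP₀⟩ := hm2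
  obtain ⟨Q, hQ⟩ := hQ
  have hbase : g j * N = t * g (j + 1) + D * m := by
    have h0 : q ^ j * M P₀ + g j * N = t * g (j + 1) + D * m := hP₀ ▸ hpoint P₀
    have hQ' := hpoint Q
    have hmQ := Nat.mul_le_mul_left D (hm1 Q)
    change D * m ≤ D * φ Q at hmQ
    rw [hQ] at hQ'
    omega
  have hmult (P : ProjPoint F (j + 2)) : q ^ j * M P + D * m = D * φ P := by
    have := hpoint P
    omega
  rw [Nat.add_sub_cancel, hgauss]
  change ((t : ℚ) = _ / _ * ((g j : ℕ) : ℚ) * _ - _) ∧ (∀ P : ProjPoint F (j + 2),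
      (M P : ℚ) = _ * ((φ P : ℚ) - _) / _) ∧ _
  have hqjQ : (q : ℚ) ^ j ≠ 0 := by positivity
  push_cast
  refine ⟨?_, fun P ↦ ?_, fun hgcd ↦ ?_⟩
  · rw [hg1] at hbase htotal
    rw [hg2, pow_succ] at htotal
    have e1 : (g j : ℚ) * N = t * (g j + q ^ j) + D * m := by exact_mod_cast hbase
    have e2 : ((g j : ℚ) + q ^ j) * N = t * (g j + q ^ j + q ^ j * q) + D * Hs.ncard := by
      exact_mod_cast htotal
    have e3 : (g j : ℚ) * q + 1 = g j + q ^ j := by exact_mod_cast hgq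
    field_simp
    linear_combination (-(g j : ℚ) - q ^ j) * e1 + (g j : ℚ) * e2 + t * (q : ℚ) ^ j * e3
  · have h : (q : ℚ) ^ j * M P + D * m = D * φ P := by exact_mod_cast hmult P
    field_simp
    linear_combination h
  · have hdvd (P : ProjPoint F (j + 2)) : D ∣ q ^ j * M P :=
      (Nat.dvd_add_left (dvd_mul_right D m)).1 (hmult P ▸ dvd_mul_right D (φ P))
    rw [Nat.add_sub_cancel_left]
    have h1 := hgcd (D / D.gcd (q ^ j)) fun P ↦
      (Nat.coprime_div_gcd_div_gcd (Nat.gcd_pos_of_pos_left _ hD)).dvd_of_dvd_mul_left <| by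
        rw [Nat.div_mul_right_comm (Nat.gcd_dvd_right _ _)]
        exact Nat.div_dvd_div (Nat.gcd_dvd_left _ _) (hdvd P)
    exact Nat.gcd_eq_left_iff_dvd.1 (Nat.eq_of_dvd_of_div_eq_one (Nat.gcd_dvd_left _ _) h1)
end

section
/- Let q be a prime power, k ≥ 2, and let ℋ' be a set of hyperplanes of PG(k−1,q) with 0 < r < [k]_q, where r := #ℋ'. Then M := Σ_{H ∈ ℋ'} χ_H is a two-character multiset with #M = r·[k−1]_q, M(H) = r·[k−2]_q + q^{k−2} for H ∈ ℋ' and M(H) = r·[k−2]_q for hyperplanes H ∉ ℋ'. Setting μ := min over points P of M(P) and g := gcd{M(P) − μ : P point}, the function M' := (1/g)·(M − μ·χ_V) is a multiset of points (i.e., ℕ-valued) with #M' = (1/g)·(r·[k−1]_q − μ·[k]_q), M'(H) = s₀ := (1/g)·(r·[k−2]_q − μ·[k−1]_q + q^{k−2}) for H ∈ ℋ' and M'(H) = t₀ := (1/g)·(r·[k−2]_q − μ·[k−1]_q) for H ∉ ℋ'; moreover g divides q^{k−2} and L(ℋ') = ⟨(s₀,t₀)⟩_ℕ + ⟨([k−1]_q,[k−1]_q)⟩_ℕ.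 -/
/-- The set `L(ℋ')` of feasible pairs `(s,t)` with `s ≥ t` for which some multiset of
points has hyperplane multiplicity `s` on every member of `ℋ'` and `t` on every other
hyperplane. -/
def Lset (F : Type) [Field F] [Fintype F] (k : ℕ) (Hs : Set (ProjHyp F k)) :
    Set (ℕ × ℕ) :=
  {st | st.2 ≤ st.1 ∧ ∃ M : ProjPoint F k → ℕ,
    (∀ H ∈ Hs, msum M H.1 = st.1) ∧
    (∀ H : ProjHyp F k, H ∉ Hs → msum M H.1 = st.2)}

open Finset Module

section Counting

variable {K V : Type*} [Field K] [AddCommGroup V] [Module K V]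

theorem card_finrank_one_le [Finite K] (S : Submodule K V) :
    Nat.card {P : Submodule K V // finrank K P = 1 ∧ P ≤ S}
      = ∑ i ∈ range (finrank K S), Nat.card K ^ i := by
  rw [← Projectivization.card_of_finrank K S rfl,
    Nat.card_congr (Projectivization.equivSubmodule K S)]
  refine Nat.card_congr (Equiv.symm ?_)
  refine ((Submodule.MapSubtype.orderIso S).toEquiv.subtypeEquiv
    (q := fun P => finrank K P.1 = 1) fun P => ?_).trans
    ((Equiv.subtypeSubtypeEquivSubtypeInter (fun P => P ≤ S)
      (fun P => finrank K P = 1)).trans (Equiv.subtypeEquivRight fun P => and_comm))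
  change finrank K P = 1 ↔ finrank K (P.map S.subtype) = 1
  rw [Submodule.finrank_map_subtype_eq]

theorem card_hyperplane_ge [Finite K] [FiniteDimensional K V] (hV : 0 < finrank K V)
    (S : Submodule K V) :
    Nat.card {H : Submodule K V // finrank K H = finrank K V - 1 ∧ S ≤ H}
      = ∑ i ∈ range (finrank K V - finrank K S), Nat.card K ^ i := by
  have hS := Subspace.finrank_add_finrank_dualAnnihilator_eq S
  rw [show finrank K V - finrank K S = finrank K S.dualAnnihilator by omega,
    ← card_finrank_one_le]
  refine Nat.card_congr (((Subspace.orderIsoFiniteDimensional (K := K) (V := V)).toEquiv.trans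
    OrderDual.ofDual).subtypeEquiv fun H => ?_)
  change _ ↔ finrank K H.dualAnnihilator = 1 ∧ H.dualAnnihilator ≤ S.dualAnnihilator
  have hH := Subspace.finrank_add_finrank_dualAnnihilator_eq H
  rw [Subspace.dualAnnihilator_le_dualAnnihilator_iff]
  exact and_congr_left fun _ => by omega

theorem finrank_sup_of_finrank_eq_one {P Q : Submodule K V} (hP : finrank K P = 1)
    (hQ : finrank K Q = 1) (hPQ : P ≠ Q) : finrank K ↥(P ⊔ Q) = 2 := by
  have : FiniteDimensional K P := .of_finrank_pos (by omega)
  have : FiniteDimensional K Q := .of_finrank_pos (by omega)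
  have h := Submodule.finrank_sup_add_finrank_inf_eq P Q
  have hlt : finrank K ↥(P ⊓ Q) < finrank K P := by
    refine Submodule.finrank_lt_finrank_of_lt (inf_lt_left.2 fun hle => hPQ ?_)
    exact Submodule.eq_of_le_of_finrank_eq hle (by omega)
  omega

theorem finrank_inf_of_hyperplanes [FiniteDimensional K V] {H H' : Submodule K V}
    (hH : finrank K H = finrank K V - 1) (hH' : finrank K H' = finrank K V - 1)
    (hne : H ≠ H') : finrank K ↥(H ⊓ H') = finrank K V - 2 := by
  have h := Submodule.finrank_sup_add_finrank_inf_eq H H'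
  have hlt : finrank K H < finrank K ↥(H ⊔ H') := by
    refine Submodule.finrank_lt_finrank_of_lt (left_lt_sup.2 fun hle => hne ?_)
    exact (Submodule.eq_of_le_of_finrank_eq hle (by omega)).symm
  have := Submodule.finrank_le (H ⊔ H')
  omega

end Counting

section Projective

variable {F : Type} [Field F] [Fintype F] {k : ℕ}

theorem gaussNum_eq_sum (m : ℕ) :
    gaussNum (Fintype.card F) m = ∑ i ∈ range m, Fintype.card F ^ i :=
  (Nat.geomSum_eq Fintype.one_lt_card m).symm

theorem gaussNum_pred (hk : 2 ≤ k) : gaussNum (Fintype.card F) (k - 1)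
    = gaussNum (Fintype.card F) (k - 2) + Fintype.card F ^ (k - 2) := by
  rw [gaussNum_eq_sum, gaussNum_eq_sum, ← sum_range_succ]
  congr 2
  omega

noncomputable instance : Fintype (Submodule F (Fin k → F)) := Fintype.ofFinite _

open Classical in
theorem msum_eq_sum {R : Type} [AddCommMonoid R] (M : ProjPoint F k → R)
    (S : Submodule F (Fin k → F)) : msum M S = ∑ P : ProjPoint F k with P.1 ≤ S, M P := by
  rw [msum, sum_filter, finsum_eq_sum_of_fintype]
  exact sum_congr rfl fun P _ => finsum_eq_if

open Classical in
theorem card_points_le (S : Submodule F (Fin k → F)) :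
    #{P : ProjPoint F k | P.1 ≤ S} = gaussNum (Fintype.card F) (finrank F S) := by
  rw [gaussNum_eq_sum, ← Nat.card_eq_fintype_card (α := F), ← card_finrank_one_le,
    ← Fintype.card_subtype, ← Nat.card_eq_fintype_card]
  exact Nat.card_congr (Equiv.subtypeSubtypeEquivSubtypeInter _ fun P => P ≤ S)

open Classical in
theorem card_hyps_ge (hk : 0 < k) (S : Submodule F (Fin k → F)) :
    #{H : ProjHyp F k | S ≤ H.1} = gaussNum (Fintype.card F) (k - finrank F S) := by
  have h := card_hyperplane_ge (K := F) (V := Fin k → F) (by simpa using hk) S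
  simp only [finrank_fin_fun] at h
  rw [gaussNum_eq_sum, ← Nat.card_eq_fintype_card (α := F), ← h,
    ← Fintype.card_subtype, ← Nat.card_eq_fintype_card]
  exact Nat.card_congr (Equiv.subtypeSubtypeEquivSubtypeInter _ fun H => S ≤ H)

theorem msum_const (c : ℕ) (S : Submodule F (Fin k → F)) :
    msum (fun _ : ProjPoint F k => c) S = gaussNum (Fintype.card F) (finrank F S) * c := by
  classical
  rw [msum_eq_sum, sum_const, card_points_le, smul_eq_mul]

theorem msum_add (M N : ProjPoint F k → ℕ) (S : Submodule F (Fin k → F)) :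
    msum (fun P => M P + N P) S = msum M S + msum N S := by
  classical
  simp only [msum_eq_sum, sum_add_distrib]

theorem msum_const_mul (c : ℕ) (M : ProjPoint F k → ℕ) (S : Submodule F (Fin k → F)) :
    msum (fun P => c * M P) S = c * msum M S := by
  classical
  simp only [msum_eq_sum, mul_sum]

open Classical in
theorem msum_sum_hyps (Hs : Set (ProjHyp F k)) (S : Submodule F (Fin k → F)) :
    msum (fun P => {H ∈ Hs | P.1 ≤ H.1}.ncard) S
      = ∑ H ∈ Hs.toFinset, gaussNum (Fintype.card F) (finrank F ↥(S ⊓ H.1)) := by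
  have h (P : ProjPoint F k) :
      {H ∈ Hs | P.1 ≤ H.1}.ncard = ∑ H ∈ Hs.toFinset, if P.1 ≤ H.1 then 1 else 0 := by
    rw [← card_filter, Set.ncard_eq_toFinset_card']
    congr 1
    ext
    simp
  simp only [msum_eq_sum, h]
  rw [sum_comm]
  refine sum_congr rfl fun H _ => ?_
  rw [← card_points_le, ← card_filter, filter_filter]
  simp only [le_inf_iff]

/-- Summing the multiplicities of all hyperplanes through a point. -/
theorem sum_msum_hyps_through (hk : 2 ≤ k) (f : ProjPoint F k → ℤ) (c : ℤ)
    (hf : ∀ H : ProjHyp F k, msum f H.1 = c) (P : ProjPoint F k) :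
    gaussNum (Fintype.card F) (k - 1) * c
      = Fintype.card F ^ (k - 2) * f P + gaussNum (Fintype.card F) (k - 2) * ∑ Q, f Q := by
  classical
  have h1 : ∑ H : ProjHyp F k with P.1 ≤ H.1, msum f H.1
      = gaussNum (Fintype.card F) (k - 1) * c := by
    rw [sum_congr rfl fun H _ => hf H, sum_const, card_hyps_ge (by omega), P.2, nsmul_eq_mul]
  have h2 : ∑ H : ProjHyp F k with P.1 ≤ H.1, msum f H.1
      = ∑ Q, (#{H : ProjHyp F k | P.1 ⊔ Q.1 ≤ H.1} : ℤ) * f Q := by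
    simp only [msum_eq_sum, sum_filter (p := fun Q : ProjPoint F k => _ ≤ _)]
    rw [sum_comm]
    refine sum_congr rfl fun Q _ => ?_
    rw [← sum_filter, filter_filter, sum_const, nsmul_eq_mul]
    simp only [sup_le_iff]
  have h3 (Q : ProjPoint F k) : (#{H : ProjHyp F k | P.1 ⊔ Q.1 ≤ H.1} : ℤ) * f Q
      = (if Q = P then (Fintype.card F : ℤ) ^ (k - 2) * f Q else 0)
        + gaussNum (Fintype.card F) (k - 2) * f Q := by
    rw [card_hyps_ge (by omega)]
    split_ifs with hQ
    · subst hQ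
      rw [sup_idem, Q.2, gaussNum_pred hk]
      push_cast
      ring
    · rw [finrank_sup_of_finrank_eq_one P.2 Q.2 fun h => hQ (Subtype.ext h.symm), zero_add]
  rw [← h1, h2, sum_congr rfl fun Q _ => h3 Q, sum_add_distrib, sum_ite_eq' univ P, mul_sum]
  simp

theorem eq_of_msum_hyps_const (hk : 2 ≤ k) (f : ProjPoint F k → ℤ) (c : ℤ)
    (hf : ∀ H : ProjHyp F k, msum f H.1 = c) (P Q : ProjPoint F k) : f P = f Q := by
  have h := (sum_msum_hyps_through hk f c hf P).symm.trans (sum_msum_hyps_through hk f c hf Q)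
  have hq : (Fintype.card F : ℤ) ^ (k - 2) ≠ 0 :=
    pow_ne_zero _ (by exact_mod_cast Fintype.card_ne_zero)
  exact mul_left_cancel₀ hq (add_right_cancel h)

theorem dvd_of_forall_dvd_mul {ι : Type*} {N : ι → ℕ} (hN : ∀ d, (∀ i, d ∣ N i) → d = 1)
    {a b : ℕ} (ha : 0 < a) (h : ∀ i, a ∣ b * N i) : a ∣ b := by
  have hg : 0 < a.gcd b := Nat.gcd_pos_of_pos_left b ha
  have h1 : a / a.gcd b = 1 := hN _ fun i => by
    refine (Nat.coprime_div_gcd_div_gcd hg).dvd_of_dvd_mul_left ?_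
    refine Nat.dvd_of_mul_dvd_mul_left hg ?_
    rw [← mul_assoc, Nat.mul_div_cancel' (Nat.gcd_dvd_left a b),
      Nat.mul_div_cancel' (Nat.gcd_dvd_right a b)]
    exact h i
  exact Nat.gcd_eq_left_iff_dvd.1 (Nat.eq_of_dvd_of_div_eq_one (Nat.gcd_dvd_left a b) h1)

end Projective

/-- main theorem. For a set `ℋ'` of hyperplanes with `0 < r < [k]_q`, the
multiset `M = Σ_{H ∈ ℋ'} χ_H` is a two-character multiset with `#M = r·[k-1]_q`,
hyperplane multiplicities `r·[k-2]_q + q^{k-2}` on `ℋ'` and `r·[k-2]_q` elsewhere.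
With `μ = min_P M(P)` and `g = gcd{M(P) − μ}`, the multiset `M' = (1/g)·(M − μ·χ_V)`
has cardinality `n'` with `g·n' = r·[k-1]_q − μ·[k]_q`, hyperplane multiplicities `s₀`
on `ℋ'` and `t₀` elsewhere with `g·s₀ = r·[k-2]_q + q^{k-2} − μ·[k-1]_q` and
`g·t₀ = r·[k-2]_q − μ·[k-1]_q`; moreover `g ∣ q^{k-2}` and
`L(ℋ') = ⟨(s₀,t₀)⟩_ℕ + ⟨([k-1]_q,[k-1]_q)⟩_ℕ`. -/
theorem main_theorem_canonical_two_character
    (F : Type) [Field F] [Fintype F] (k : ℕ) (hk : 2 ≤ k)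
    (Hs : Set (ProjHyp F k))
    (hr1 : 0 < Hs.ncard) (hr2 : Hs.ncard < gaussNum (Fintype.card F) k)
    (M : ProjPoint F k → ℕ)
    (hM : ∀ P : ProjPoint F k, M P = {H ∈ Hs | P.1 ≤ H.1}.ncard)
    (μ : ℕ) (hμ1 : ∀ P : ProjPoint F k, μ ≤ M P) (hμ2 : ∃ P : ProjPoint F k, M P = μ)
    (g : ℕ) (hg1 : ∀ P : ProjPoint F k, g ∣ (M P - μ))
    (hg2 : ∀ d : ℕ, (∀ P : ProjPoint F k, d ∣ (M P - μ)) → d ∣ g) :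
    msum M (⊤ : Submodule F (Fin k → F)) = Hs.ncard * gaussNum (Fintype.card F) (k - 1) ∧
    (∀ H ∈ Hs, msum M H.1
      = Hs.ncard * gaussNum (Fintype.card F) (k - 2) + Fintype.card F ^ (k - 2)) ∧
    (∀ H : ProjHyp F k, H ∉ Hs →
      msum M H.1 = Hs.ncard * gaussNum (Fintype.card F) (k - 2)) ∧
    g ∣ Fintype.card F ^ (k - 2) ∧
    ∃ s₀ t₀ n' : ℕ,
      g * s₀ + μ * gaussNum (Fintype.card F) (k - 1)
        = Hs.ncard * gaussNum (Fintype.card F) (k - 2) + Fintype.card F ^ (k - 2) ∧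
      g * t₀ + μ * gaussNum (Fintype.card F) (k - 1)
        = Hs.ncard * gaussNum (Fintype.card F) (k - 2) ∧
      g * n' + μ * gaussNum (Fintype.card F) k
        = Hs.ncard * gaussNum (Fintype.card F) (k - 1) ∧
      msum (fun P => (M P - μ) / g) (⊤ : Submodule F (Fin k → F)) = n' ∧
      (∀ H ∈ Hs, msum (fun P => (M P - μ) / g) H.1 = s₀) ∧
      (∀ H : ProjHyp F k, H ∉ Hs → msum (fun P => (M P - μ) / g) H.1 = t₀) ∧
      Lset F k Hs =
        {st : ℕ × ℕ | ∃ u v : ℕ,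
          st = (u * s₀ + v * gaussNum (Fintype.card F) (k - 1),
                u * t₀ + v * gaussNum (Fintype.card F) (k - 1))} := by
  classical
  set q := Fintype.card F
  set r := Hs.ncard with hr
  have hMfun : M = fun P => {H ∈ Hs | P.1 ≤ H.1}.ncard := funext hM
  have hrc : #Hs.toFinset = r := (Set.ncard_eq_toFinset_card' Hs).symm
  have hcard : Nat.card (ProjHyp F k) = gaussNum q k := by
    have h := card_hyps_ge (F := F) (k := k) (by omega) ⊥
    simpa [Nat.card_eq_fintype_card] using h
  obtain ⟨H₁, hH₁⟩ : Hs.Nonempty := Set.nonempty_of_ncard_ne_zero hr1.ne'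
  obtain ⟨H₂, hH₂⟩ : ∃ H, H ∉ Hs := by
    by_contra! h
    rw [hr, Set.eq_univ_of_forall h, Set.ncard_univ, hcard] at hr2
    exact hr2.false
  have hinf (H H' : ProjHyp F k) (hne : H ≠ H') : finrank F ↥(H.1 ⊓ H'.1) = k - 2 := by
    have h := finrank_inf_of_hyperplanes (K := F) (V := Fin k → F) (H := H.1) (H' := H'.1)
      (by simpa using H.2) (by simpa using H'.2) (fun h => hne (Subtype.ext h))
    simpa using h
  have htop : msum M (⊤ : Submodule F (Fin k → F)) = r * gaussNum q (k - 1) := by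
    rw [hMfun, msum_sum_hyps, ← hrc, ← smul_eq_mul, ← sum_const]
    exact sum_congr rfl fun H _ => by rw [top_inf_eq, H.2]
  have hin (H : ProjHyp F k) (hH : H ∈ Hs) :
      msum M H.1 = r * gaussNum q (k - 2) + q ^ (k - 2) := by
    have hmem : H ∈ Hs.toFinset := by simpa using hH
    rw [hMfun, msum_sum_hyps, ← add_sum_erase _ _ hmem, inf_idem, H.2, gaussNum_pred hk,
      sum_congr rfl fun H' hH' => by rw [hinf H H' (ne_of_mem_erase hH').symm], sum_const,
      card_erase_of_mem hmem, hrc, smul_eq_mul]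
    obtain ⟨r', hr'⟩ : ∃ r', r = r' + 1 := ⟨r - 1, by omega⟩
    rw [hr', Nat.add_sub_cancel]
    ring
  have hout (H : ProjHyp F k) (hH : H ∉ Hs) : msum M H.1 = r * gaussNum q (k - 2) := by
    rw [hMfun, msum_sum_hyps, ← hrc, ← smul_eq_mul, ← sum_const]
    refine sum_congr rfl fun H' hH' => ?_
    rw [hinf H H']
    rintro rfl
    exact hH (by simpa using hH')
  set M' : ProjPoint F k → ℕ := fun P => (M P - μ) / g with hM'
  have hgM' (P : ProjPoint F k) : g * M' P = M P - μ := Nat.mul_div_cancel' (hg1 P)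
  have hMM' (P : ProjPoint F k) : M P = g * M' P + μ := by
    rw [hgM', Nat.sub_add_cancel (hμ1 P)]
  have hlin (S : Submodule F (Fin k → F)) :
      g * msum M' S + μ * gaussNum q (finrank F S) = msum M S := by
    rw [funext hMM', msum_add, msum_const_mul, msum_const, mul_comm μ]
  have hlinH (H : ProjHyp F k) : g * msum M' H.1 + μ * gaussNum q (k - 1) = msum M H.1 := by
    rw [← hlin, H.2]
  have hs₀ := (hlinH H₁).trans (hin H₁ hH₁)
  have ht₀ := (hlinH H₂).trans (hout H₂ hH₂)
  have hdiff : g * msum M' H₁.1 = g * msum M' H₂.1 + q ^ (k - 2) := by omega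
  have hgdvd : g ∣ q ^ (k - 2) :=
    (Nat.dvd_add_right (dvd_mul_right _ _)).1 (hdiff ▸ dvd_mul_right g _)
  have hqpos : 0 < q ^ (k - 2) := pow_pos Fintype.card_pos _
  have hg : 0 < g := Nat.pos_of_dvd_of_pos hgdvd hqpos
  have hin' (H : ProjHyp F k) (hH : H ∈ Hs) : msum M' H.1 = msum M' H₁.1 :=
    Nat.eq_of_mul_eq_mul_left hg (by have := hlinH H; rw [hin H hH] at this; omega)
  have hout' (H : ProjHyp F k) (hH : H ∉ Hs) : msum M' H.1 = msum M' H₂.1 :=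
    Nat.eq_of_mul_eq_mul_left hg (by have := hlinH H; rw [hout H hH] at this; omega)
  refine ⟨htop, hin, hout, hgdvd, msum M' H₁.1, msum M' H₂.1, msum M' ⊤, hs₀, ht₀, ?_, rfl,
    hin', hout', ?_⟩
  · have h := hlin ⊤
    rwa [finrank_top, finrank_fin_fun, htop] at h
  have hcomb (u v : ℕ) (H : ProjHyp F k) : msum (fun P => u * M' P + v) H.1
      = u * msum M' H.1 + v * gaussNum q (k - 1) := by
    rw [msum_add, msum_const_mul, msum_const, H.2, mul_comm v]
  ext ⟨s, t⟩
  simp only [Lset, Set.mem_ofPred_eq, Prod.mk.injEq]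
  constructor
  · rintro ⟨hts, N, hNs, hNt⟩
    obtain ⟨P₀, hP₀⟩ := hμ2
    obtain ⟨d, rfl⟩ := Nat.exists_eq_add_of_le hts
    obtain ⟨h, hh⟩ := hgdvd
    have hhpos : 0 < h := Nat.pos_of_ne_zero fun h0 => by
      rw [hh, h0, mul_zero] at hqpos
      exact hqpos.false
    have hconst (P : ProjPoint F k) := eq_of_msum_hyps_const hk
      (fun P => (q : ℤ) ^ (k - 2) * N P - d * M P)
      ((q : ℤ) ^ (k - 2) * t - d * (r * gaussNum q (k - 2))) (fun H => by
        have key : msum (fun P => (q : ℤ) ^ (k - 2) * N P - d * M P) H.1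
            = (q : ℤ) ^ (k - 2) * (msum N H.1 : ℕ) - d * (msum M H.1 : ℕ) := by
          simp only [msum_eq_sum, sum_sub_distrib, mul_sum, Nat.cast_sum]
        rw [key]
        by_cases hH : H ∈ Hs
        · rw [hNs H hH, hin H hH]
          push_cast
          ring
        · rw [hNt H hH, hout H hH]
          push_cast
          ring) P P₀
    have hrel (P : ProjPoint F k) : (h : ℤ) * (N P - N P₀) = d * M' P := by
      have h1 := hconst P
      have hhz : (q : ℤ) ^ (k - 2) = g * h := by exact_mod_cast hh
      have h2 : (M P : ℤ) = g * M' P + μ := by exact_mod_cast hMM' P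
      simp only [hP₀, h2, hhz] at h1
      have hgz : (g : ℤ) ≠ 0 := by exact_mod_cast hg.ne'
      apply mul_left_cancel₀ hgz
      linear_combination h1
    have hgcd (c : ℕ) (hc : ∀ P, c ∣ M' P) : c = 1 := by
      have h1 : g * c ∣ g := hg2 _ fun P => by
        rw [← hgM']
        exact mul_dvd_mul_left g (hc P)
      exact Nat.dvd_one.1 (Nat.dvd_of_mul_dvd_mul_left hg (by simpa using h1))
    obtain ⟨u, rfl⟩ : h ∣ d := dvd_of_forall_dvd_mul hgcd hhpos fun P =>
      Int.natCast_dvd_natCast.1 ⟨_, by rw [hrel P]; push_cast; ring⟩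
    have hN : N = fun P => u * M' P + N P₀ := funext fun P => by
      have h1 := hrel P
      have hhz : (h : ℤ) ≠ 0 := by exact_mod_cast hhpos.ne'
      have h2 : (N P : ℤ) - N P₀ = u * M' P := by
        apply mul_left_cancel₀ hhz
        rw [h1]
        push_cast
        ring
      zify
      linarith
    refine ⟨u, N P₀, ?_, ?_⟩
    · rw [← hcomb, ← hN, hNs H₁ hH₁]
    · rw [← hcomb, ← hN, hNt H₂ hH₂]
  · rintro ⟨u, v, rfl, rfl⟩
    refine ⟨?_, fun P => u * M' P + v, fun H hH => ?_, fun H hH => ?_⟩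
    · have hle : msum M' H₂.1 ≤ msum M' H₁.1 :=
        Nat.le_of_mul_le_mul_left (by omega) hg
      gcongr
    · rw [hcomb, hin' H hH]
    · rw [hcomb, hout' H hH]
end

section
/- Let q be a prime power, k ≥ 2, and let M̃ be a two-character multiset in PG(k−1,q) whose hyperplane multiplicities take exactly the two values s > t. Let ℋ' := {H hyperplane : M̃(H) = s}, M := Σ_{H ∈ ℋ'} χ_H, μ := min over points P of M(P), g := gcd{M(P) − μ : P point}, and M' := (1/g)·(M − μ·χ_V). Then there exist unique u, v ∈ ℕ such that M̃ = u·M' + v·χ_V (pointwise). -/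
/-- Two subspaces of equal dimension are related by an automorphism of the ambient space. -/
theorem Submodule.exists_linearEquiv_map_eq_of_finrank_eq {F V : Type*} [Field F]
    [AddCommGroup V] [Module F V] [FiniteDimensional F V] (W W' : Submodule F V)
    (h : Module.finrank F W = Module.finrank F W') :
    ∃ e : V ≃ₗ[F] V, W.map e.toLinearMap = W' := by
  obtain ⟨C, hC⟩ := W.exists_isCompl
  obtain ⟨C', hC'⟩ := W'.exists_isCompl
  have hCC : Module.finrank F C = Module.finrank F C' := by
    have h1 := Submodule.finrank_add_eq_of_isCompl hC
    have h2 := Submodule.finrank_add_eq_of_isCompl hC'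
    omega
  let e₁ := LinearEquiv.ofFinrankEq W W' h
  let e₂ := LinearEquiv.ofFinrankEq C C' hCC
  let e : V ≃ₗ[F] V := (Submodule.prodEquivOfIsCompl W C hC).symm ≪≫ₗ
    (e₁.prodCongr e₂) ≪≫ₗ Submodule.prodEquivOfIsCompl W' C' hC'
  refine ⟨e, Submodule.eq_of_le_of_finrank_eq ?_ ?_⟩
  · rintro _ ⟨x, hx, rfl⟩
    have : e x = e₁ ⟨x, hx⟩ := by
      have hx' : (Submodule.prodEquivOfIsCompl W C hC).symm x = (⟨x, hx⟩, 0) :=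
        Submodule.prodEquivOfIsCompl_symm_apply_left W C hC ⟨x, hx⟩
      simp [e, hx']
    simp [this]
  · rw [← h]
    exact LinearEquiv.finrank_map_eq e W

/-- A linear automorphism permutes the subspaces of a given dimension. -/
def Submodule.mapFinrankEquiv {F V : Type*} [Field F] [AddCommGroup V] [Module F V]
    (e : V ≃ₗ[F] V) (d : ℕ) :
    {W : Submodule F V // Module.finrank F W = d} ≃
      {W : Submodule F V // Module.finrank F W = d} :=
  (Submodule.orderIsoMapComap e).toEquiv.subtypeEquiv fun W => by
    change _ ↔ Module.finrank F (W.map e.toLinearMap) = d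
    rw [← LinearEquiv.finrank_map_eq e W]

theorem Submodule.coe_mapFinrankEquiv {F V : Type*} [Field F] [AddCommGroup V] [Module F V]
    (e : V ≃ₗ[F] V) (d : ℕ) (W : {W : Submodule F V // Module.finrank F W = d}) :
    (Submodule.mapFinrankEquiv e d W).1 = W.1.map e.toLinearMap := rfl

theorem Submodule.map_linearEquiv_le_iff {F V : Type*} [Field F] [AddCommGroup V] [Module F V]
    (e : V ≃ₗ[F] V) (W U : Submodule F V) :
    W.map e.toLinearMap ≤ U.map e.toLinearMap ↔ W ≤ U :=
  Submodule.map_le_map_iff_of_injective e.injective W U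

/-- The number of hyperplanes containing a given subspace. -/
noncomputable def hypCount {F : Type} [Field F] {k : ℕ} (W : Submodule F (Fin k → F)) : ℕ :=
  {H : ProjHyp F k | W ≤ H.1}.ncard

theorem hypCount_eq_of_finrank_eq {F : Type} [Field F] {k : ℕ} (W W' : Submodule F (Fin k → F))
    (h : Module.finrank F W = Module.finrank F W') : hypCount W = hypCount W' := by
  obtain ⟨e, rfl⟩ := Submodule.exists_linearEquiv_map_eq_of_finrank_eq W W' h
  refine Set.ncard_congr' ((Submodule.mapFinrankEquiv e (k - 1)).subtypeEquiv fun H => ?_)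
  change W ≤ H.1 ↔ W.map e.toLinearMap ≤ H.1.map e.toLinearMap
  rw [Submodule.map_linearEquiv_le_iff]

theorem msum_const_eq_of_finrank_eq {F : Type} [Field F] {k : ℕ} {R : Type} [AddCommMonoid R]
    (c : R) (W W' : Submodule F (Fin k → F)) (h : Module.finrank F W = Module.finrank F W') :
    msum (fun _ : ProjPoint F k => c) W = msum (fun _ => c) W' := by
  obtain ⟨e, rfl⟩ := Submodule.exists_linearEquiv_map_eq_of_finrank_eq W W' h
  unfold msum
  refine finsum_eq_of_bijective (Submodule.mapFinrankEquiv e 1)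
    (Submodule.mapFinrankEquiv e 1).bijective fun P => ?_
  rw [Submodule.coe_mapFinrankEquiv, Submodule.map_linearEquiv_le_iff]

theorem ProjPoint.not_le_of_ne {F : Type} [Field F] {k : ℕ} {P Q : ProjPoint F k} (h : P ≠ Q) :
    ¬ Q.1 ≤ P.1 := fun hle =>
  h (Subtype.ext (Submodule.eq_of_le_of_finrank_eq hle (Q.2.trans P.2.symm)).symm)

theorem ProjPoint.finrank_sup {F : Type} [Field F] {k : ℕ} {P Q : ProjPoint F k} (h : P ≠ Q) :
    Module.finrank F ↥(P.1 ⊔ Q.1) = 2 := by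
  have hinf : P.1 ⊓ Q.1 = ⊥ := by
    rw [← Submodule.finrank_eq_zero (R := F)]
    have hlt : P.1 ⊓ Q.1 < Q.1 := lt_of_le_of_ne inf_le_right fun he =>
      ProjPoint.not_le_of_ne h (inf_eq_right.mp he)
    have := Submodule.finrank_lt_finrank_of_lt hlt
    rw [Q.2] at this
    omega
  have := Submodule.finrank_sup_add_finrank_inf_eq P.1 Q.1
  rw [hinf, finrank_bot, P.2, Q.2] at this
  omega

theorem hypCount_sup_lt {F : Type} [Field F] [Finite F] {k : ℕ} {P Q : ProjPoint F k}
    (h : P ≠ Q) : hypCount (P.1 ⊔ Q.1) < hypCount P.1 := by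
  obtain ⟨x, hxQ, hxP⟩ := SetLike.not_le_iff_exists.mp (ProjPoint.not_le_of_ne h)
  obtain ⟨f, hfx, hf⟩ := Submodule.exists_le_ker_of_notMem hxP
  have hf0 : f ≠ 0 := by
    rintro rfl
    exact hfx rfl
  have hrank : Module.finrank F (LinearMap.ker f) = k - 1 := by
    have := Module.Dual.finrank_ker_add_one_of_ne_zero hf0
    simp only [Module.finrank_fin_fun] at this
    omega
  refine Set.ncard_lt_ncard ⟨fun H (hH : P.1 ⊔ Q.1 ≤ H.1) =>
    show P.1 ≤ H.1 from le_sup_left.trans hH, fun hsub => ?_⟩ (Set.toFinite _)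
  have hmem : P.1 ⊔ Q.1 ≤ LinearMap.ker f := hsub (a := ⟨LinearMap.ker f, hrank⟩) hf
  exact hfx (hmem (le_sup_right (a := P.1) hxQ))

/-- Double counting of the pairs `(H, Q)` with `P, Q ≤ H`, weighted by `N Q`. -/
theorem finsum_msum_hyp {F : Type} [Field F] [Fintype F] {k : ℕ}
    [Fintype (ProjPoint F k)] [Fintype (ProjHyp F k)] (N : ProjPoint F k → ℕ)
    (P : ProjPoint F k) :
    ∑ᶠ (H : ProjHyp F k) (_ : P.1 ≤ H.1), msum N H.1 =
      ∑ Q : ProjPoint F k, N Q * hypCount (P.1 ⊔ Q.1) := by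
  classical
  simp only [msum, hypCount, finsum_eq_sum_of_fintype, finsum_eq_if,
    Set.ncard_eq_toFinset_card', Set.toFinset_ofPred, Finset.card_filter, Finset.mul_sum, sup_le_iff]
  rw [Finset.sum_comm]
  refine Finset.sum_congr rfl fun H _ => ?_
  by_cases hP : P.1 ≤ H.1 <;> simp [hP]

theorem dvd_mul_gcd_of_forall_dvd_mul {ι : Type*} {f : ι → ℕ} {g c d : ℕ} (hd : 0 < d)
    (hg : ∀ e : ℕ, (∀ i, e ∣ f i) → e ∣ g) (h : ∀ i, d ∣ c * f i) : d ∣ c * g := by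
  have hpos := Nat.gcd_pos_of_pos_left c hd
  have hco : Nat.Coprime (d / d.gcd c) (c / d.gcd c) := Nat.coprime_div_gcd_div_gcd hpos
  have hdd := Nat.div_mul_cancel (Nat.gcd_dvd_left d c)
  have hcc := Nat.div_mul_cancel (Nat.gcd_dvd_right d c)
  have key : d / d.gcd c ∣ g := hg _ fun i => by
    refine hco.dvd_of_dvd_mul_left (Nat.dvd_of_mul_dvd_mul_right hpos ?_)
    rw [hdd, mul_right_comm, hcc]
    exact h i
  calc d = d.gcd c * (d / d.gcd c) := by rw [mul_comm, hdd]
    _ ∣ c * g := Nat.mul_dvd_mul (Nat.gcd_dvd_right d c) key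

/-- A two-character multiset and the sum of its heavy hyperplanes determine each other affinely. -/
theorem exists_affine_relation {F : Type} [Field F] [Fintype F] {k : ℕ}
    (Mt : ProjPoint F k → ℕ) {s t : ℕ} (hst : t < s)
    (h2 : ∀ H : ProjHyp F k, msum Mt H.1 = s ∨ msum Mt H.1 = t)
    (M : ProjPoint F k → ℕ)
    (hM : ∀ P : ProjPoint F k,
      M P = {H : ProjHyp F k | msum Mt H.1 = s ∧ P.1 ≤ H.1}.ncard) :
    ∃ d : ℕ, 0 < d ∧ ∀ P Q : ProjPoint F k,
      (d : ℤ) * (Mt P - Mt Q) = (s - t : ℤ) * (M P - M Q) := by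
  classical
  let _ : Fintype (ProjPoint F k) := Fintype.ofFinite _
  let _ : Fintype (ProjHyp F k) := Fintype.ofFinite _
  by_cases hex : ∃ P₁ P₂ : ProjPoint F k, P₁ ≠ P₂
  swap
  · push Not at hex
    exact ⟨1, one_pos, fun P Q => by rw [hex P Q]; ring⟩
  obtain ⟨P₁, P₂, h12⟩ := hex
  have hlt := hypCount_sup_lt h12
  refine ⟨hypCount P₁.1 - hypCount (P₁.1 ⊔ P₂.1), by omega, ?_⟩
  have heavy : ∀ P : ProjPoint F k,
      (∑ᶠ (H : ProjHyp F k) (_ : P.1 ≤ H.1), msum Mt H.1) =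
        t * hypCount P₁.1 + (s - t) * M P := by
    intro P
    rw [hypCount_eq_of_finrank_eq P₁.1 P.1 (P₁.2.trans P.2.symm), hM P]
    simp only [hypCount, finsum_eq_sum_of_fintype, finsum_eq_if, Set.ncard_eq_toFinset_card',
      Set.toFinset_ofPred, Finset.card_filter, Finset.mul_sum]
    rw [← Finset.sum_add_distrib]
    refine Finset.sum_congr rfl fun H _ => ?_
    by_cases hP : P.1 ≤ H.1
    · rcases h2 H with h | h
      · simp [hP, h]; omega
      · simp [hP, h, hst.ne]
    · simp [hP]
  have light : ∀ P : ProjPoint F k,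
      ((∑ Q : ProjPoint F k, Mt Q * hypCount (P.1 ⊔ Q.1) : ℕ) : ℤ) =
        (hypCount P₁.1 - hypCount (P₁.1 ⊔ P₂.1) : ℤ) * Mt P +
          hypCount (P₁.1 ⊔ P₂.1) * ∑ Q : ProjPoint F k, (Mt Q : ℤ) := by
    intro P
    have hterm : ∀ Q : ProjPoint F k, ((Mt Q * hypCount (P.1 ⊔ Q.1) : ℕ) : ℤ) =
        (if P = Q then (hypCount P₁.1 - hypCount (P₁.1 ⊔ P₂.1) : ℤ) * Mt Q else 0) +
          hypCount (P₁.1 ⊔ P₂.1) * (Mt Q : ℤ) := by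
      intro Q
      by_cases hPQ : P = Q
      · subst hPQ
        rw [sup_idem, hypCount_eq_of_finrank_eq P.1 P₁.1 (P.2.trans P₁.2.symm)]
        simp only [if_true]
        push_cast
        ring
      · rw [hypCount_eq_of_finrank_eq (P.1 ⊔ Q.1) (P₁.1 ⊔ P₂.1)
          ((ProjPoint.finrank_sup hPQ).trans (ProjPoint.finrank_sup h12).symm)]
        simp only [hPQ, if_false]
        push_cast
        ring
    rw [Nat.cast_sum, Finset.sum_congr rfl fun Q _ => hterm Q, Finset.sum_add_distrib,
      Finset.sum_ite_eq, ← Finset.mul_sum]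
    simp
  intro P Q
  have hP := light P
  have hQ := light Q
  rw [← finsum_msum_hyp, heavy] at hP hQ
  push_cast [Nat.cast_sub hlt.le, Nat.cast_sub hst.le] at hP hQ ⊢
  linear_combination hQ - hP

/-- every two-character multiset `M̃` with hyperplane multiplicities exactly
`s > t` can be written uniquely as `M̃ = u·M' + v·χ_V` with `u, v ∈ ℕ`, where
`M' = (1/g)·(M − μ·χ_V)`, `M = Σ_{H : M̃(H) = s} χ_H`, `μ = min_P M(P)` and
`g = gcd{M(P) − μ}`. -/
theorem unique_decomposition_two_character
    (F : Type) [Field F] [Fintype F] (k : ℕ) (hk : 2 ≤ k)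
    (Mt : ProjPoint F k → ℕ) (s t : ℕ) (hst : t < s)
    (h2 : ∀ H : ProjHyp F k, msum Mt H.1 = s ∨ msum Mt H.1 = t)
    (hs : ∃ H : ProjHyp F k, msum Mt H.1 = s)
    (ht : ∃ H : ProjHyp F k, msum Mt H.1 = t)
    (M : ProjPoint F k → ℕ)
    (hM : ∀ P : ProjPoint F k,
      M P = {H : ProjHyp F k | msum Mt H.1 = s ∧ P.1 ≤ H.1}.ncard)
    (μ : ℕ) (hμ1 : ∀ P : ProjPoint F k, μ ≤ M P) (hμ2 : ∃ P : ProjPoint F k, M P = μ)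
    (g : ℕ) (hg1 : ∀ P : ProjPoint F k, g ∣ (M P - μ))
    (hg2 : ∀ d : ℕ, (∀ P : ProjPoint F k, d ∣ (M P - μ)) → d ∣ g) :
    ∃! uv : ℕ × ℕ, ∀ P : ProjPoint F k, Mt P = uv.1 * ((M P - μ) / g) + uv.2 := by
  obtain ⟨d, hd, hrel⟩ := exists_affine_relation Mt hst h2 M hM
  obtain ⟨P₀, hP₀⟩ := hμ2
  have hnat : ∀ P, d * Mt P = (s - t) * (M P - μ) + d * Mt P₀ := by
    intro P
    have h := hrel P P₀
    rw [hP₀] at h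
    zify [hst.le, hμ1 P]
    linear_combination h
  obtain ⟨P₁, hP₁⟩ : ∃ P, M P ≠ μ := by
    by_contra! hcon
    have hconst : Mt = fun _ => Mt P₀ := funext fun P => by
      have h := hnat P
      rw [hcon P, Nat.sub_self, mul_zero, zero_add] at h
      exact Nat.eq_of_mul_eq_mul_left hd h
    obtain ⟨H, hH⟩ := hs
    obtain ⟨H', hH'⟩ := ht
    rw [hconst] at hH hH'
    exact hst.ne (hH'.symm.trans
      ((msum_const_eq_of_finrank_eq _ _ _ (H'.2.trans H.2.symm)).trans hH))
  have hne : M P₁ - μ ≠ 0 := by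
    have := hμ1 P₁
    omega
  have hquot : (M P₁ - μ) / g ≠ 0 := fun h => hne (by
    rw [← Nat.div_mul_cancel (hg1 P₁), h, zero_mul])
  obtain ⟨u, hu⟩ : d ∣ (s - t) * g :=
    dvd_mul_gcd_of_forall_dvd_mul hd hg2 fun P =>
      (Nat.dvd_add_left (dvd_mul_right d (Mt P₀))).mp (hnat P ▸ dvd_mul_right d (Mt P))
  have hdecomp : ∀ P, Mt P = u * ((M P - μ) / g) + Mt P₀ := by
    intro P
    refine Nat.eq_of_mul_eq_mul_left hd ?_
    rw [hnat P, mul_add, ← mul_assoc, ← hu, mul_assoc, Nat.mul_div_cancel' (hg1 P)]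
  refine ⟨(u, Mt P₀), hdecomp, ?_⟩
  rintro ⟨u', v'⟩ h'
  have hv : Mt P₀ = v' := by simpa [hP₀] using h' P₀
  have hu' := h' P₁
  rw [hdecomp P₁, ← hv] at hu'
  have := Nat.eq_of_mul_eq_mul_right (Nat.pos_of_ne_zero hquot) (Nat.add_right_cancel hu')
  rw [this, hv]
end
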